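/- Realizations of a continuous dynamical system lie in an ergodic algebra: let Q be a compact Hausdorff topological space, T : ℝ^d × Q → Q a jointly continuous map with T(0,·) = id and T(x+y,·) = T(x, T(y,·)) for all x, y ∈ ℝ^d, let μ be a regular Borel probability measure on Q invariant under every map T(x,·), and let V ⊆ C(Q; ℝ) be a separable linear subspace. Then for μ-almost every ω ∈ Q there exists a set 𝒜 ⊆ BUC(ℝ^d) which is an algebra with mean value satisfying the ergodicity criterion, and such that for every f ∈ V the realization y ↦ f(T(y, ω)) belongs to 𝒜. -/

import Mathlib

open MeasureTheory Filter Topology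

/-- The translate of a bounded continuous function `f` by `l`: the function `x ↦ f (x + l)`. -/
noncomputable def translateBCF {d : ℕ}
    (f : BoundedContinuousFunction (EuclideanSpace ℝ (Fin d)) ℝ)
    (l : EuclideanSpace ℝ (Fin d)) :
    BoundedContinuousFunction (EuclideanSpace ℝ (Fin d)) ℝ :=
  f.compContinuous ⟨fun x => x + l, by continuity⟩

/-- `𝒜` is an algebra with mean value: a translation-invariant, sup-norm-closed unital
subalgebra of `BUC(ℝ^d)` all of whose members possess a mean value. -/
def IsAlgebraWithMeanValue {d : ℕ}
    (𝒜 : Set (BoundedContinuousFunction (EuclideanSpace ℝ (Fin d)) ℝ)) : Prop :=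
  (∀ f ∈ 𝒜, UniformContinuous ⇑f) ∧
  (∀ f ∈ 𝒜, ∀ g ∈ 𝒜, f + g ∈ 𝒜) ∧
  (∀ (c : ℝ), ∀ f ∈ 𝒜, c • f ∈ 𝒜) ∧
  (∀ f ∈ 𝒜, ∀ g ∈ 𝒜, f * g ∈ 𝒜) ∧
  IsClosed 𝒜 ∧
  (1 : BoundedContinuousFunction (EuclideanSpace ℝ (Fin d)) ℝ) ∈ 𝒜 ∧
  (∀ f ∈ 𝒜, ∀ y : EuclideanSpace ℝ (Fin d), translateBCF f y ∈ 𝒜) ∧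
  (∀ f ∈ 𝒜, ∃ c : ℝ,
    Tendsto (fun R : ℝ =>
      ⨍ y in Metric.ball (0 : EuclideanSpace ℝ (Fin d)) R, f y) atTop (𝓝 c))

/-- `𝒜` satisfies the ergodicity criterion of Jikov–Kozlov–Oleinik: for every `f ∈ 𝒜`,
with mean value `c`, the quadratic means of the deviations of the sliding ball averages
of `f` from `c` tend to `0`. -/
def SatisfiesErgodicityCriterion {d : ℕ}
    (𝒜 : Set (BoundedContinuousFunction (EuclideanSpace ℝ (Fin d)) ℝ)) : Prop :=
  ∀ f ∈ 𝒜, ∃ c : ℝ,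
    Tendsto (fun R : ℝ =>
        ⨍ y in Metric.ball (0 : EuclideanSpace ℝ (Fin d)) R, f y) atTop (𝓝 c) ∧
    Tendsto (fun t : ℝ =>
        limsup (fun L : ℝ =>
            ⨍ y in Metric.ball (0 : EuclideanSpace ℝ (Fin d)) L,
              |(⨍ x in Metric.ball (0 : EuclideanSpace ℝ (Fin d)) t, f (x + y)) - c| ^ 2)
          atTop)
      atTop (𝓝 0)

section Sliding

variable {d : ℕ}

local notation "𝔼" => EuclideanSpace ℝ (Fin d)

open BoundedContinuousFunction (const const_apply norm_le norm_coe_le_norm ofNormedAddCommGroup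
  coe_ofNormedAddCommGroup)

theorem BoundedContinuousFunction.abs_apply {X : Type*} [TopologicalSpace X]
    (F : BoundedContinuousFunction X ℝ) (x : X) : |F| x = |F x| := rfl

theorem translateBCF_apply (F : BoundedContinuousFunction 𝔼 ℝ) (l y : 𝔼) :
    translateBCF F l y = F (y + l) := rfl

theorem norm_translateBCF_le (F : BoundedContinuousFunction 𝔼 ℝ) (l : 𝔼) :
    ‖translateBCF F l‖ ≤ ‖F‖ :=
  (norm_le (norm_nonneg _)).2 fun y => F.norm_coe_le_norm (y + l)

theorem volume_ball_ne_zero (x : 𝔼) {t : ℝ} (ht : 0 < t) :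
    volume (Metric.ball x t) ≠ 0 := (Metric.measure_ball_pos volume x ht).ne'

theorem integrableOn_ball (F : BoundedContinuousFunction 𝔼 ℝ) (x : 𝔼) (t : ℝ) :
    IntegrableOn F (Metric.ball x t) := by
  have : IsFiniteMeasure (volume.restrict (Metric.ball x t)) :=
    isFiniteMeasure_restrict.2 measure_ball_lt_top.ne
  exact F.integrable _

theorem continuous_setAverage_ball (F : BoundedContinuousFunction 𝔼 ℝ) (t : ℝ) :
    Continuous fun y : 𝔼 => ⨍ x in Metric.ball (0 : 𝔼) t, F (x + y) := by
  have : IsFiniteMeasure (volume.restrict (Metric.ball (0 : 𝔼) t)) :=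
    isFiniteMeasure_restrict.2 measure_ball_lt_top.ne
  have h : Continuous fun y : 𝔼 => ∫ x in Metric.ball (0 : 𝔼) t, F (x + y) := by
    refine continuous_of_dominated (bound := fun _ => ‖F‖)
      (fun y => ?_) (fun y => ?_) (integrable_const _) ?_
    · exact (F.continuous.comp (by fun_prop)).aestronglyMeasurable
    · exact Eventually.of_forall fun x => F.norm_coe_le_norm _
    · exact Eventually.of_forall fun x => F.continuous.comp (by fun_prop)
  simp only [setAverage_eq]
  exact h.const_smul (volume.real (Metric.ball (0 : 𝔼) t))⁻¹

theorem norm_setAverage_ball_le (f : 𝔼 → ℝ) {C : ℝ} (hC : 0 ≤ C) (x : 𝔼) (t : ℝ)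
    (h : ∀ y ∈ Metric.ball x t, ‖f y‖ ≤ C) : ‖⨍ y in Metric.ball x t, f y‖ ≤ C := by
  rw [setAverage_eq, norm_smul, norm_inv, Real.norm_of_nonneg measureReal_nonneg]
  have h1 := norm_setIntegral_le_of_norm_le_const (μ := volume)
    (measure_ball_lt_top (x := x) (r := t)) h
  rcases eq_or_lt_of_le (measureReal_nonneg (μ := volume) (s := Metric.ball x t)) with h0 | h0
  · simpa [← h0] using hC
  · rwa [inv_mul_le_iff₀ h0, mul_comm]

/-- The sliding averages `y ↦ ⨍ x in ball 0 t, F (x + y)`. -/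
noncomputable def slidingAverage (t : ℝ) :
    BoundedContinuousFunction 𝔼 ℝ →ₗ[ℝ] BoundedContinuousFunction 𝔼 ℝ where
  toFun F := ofNormedAddCommGroup (fun y => ⨍ x in Metric.ball (0 : 𝔼) t, F (x + y))
    (continuous_setAverage_ball F t) ‖F‖ fun y =>
      norm_setAverage_ball_le _ (norm_nonneg _) _ _ fun x _ => F.norm_coe_le_norm (x + y)
  map_add' F G := by
    ext y
    simp only [coe_ofNormedAddCommGroup, BoundedContinuousFunction.add_apply, setAverage_eq]
    have h := integral_add (integrableOn_ball (translateBCF F y) 0 t)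
      (integrableOn_ball (translateBCF G y) 0 t)
    simp only [translateBCF_apply] at h
    rw [h, smul_add]
  map_smul' c F := by
    ext y
    simp only [coe_ofNormedAddCommGroup, BoundedContinuousFunction.smul_apply, setAverage_eq,
      RingHom.id_apply]
    rw [integral_smul, smul_comm]

theorem slidingAverage_apply (t : ℝ) (F : BoundedContinuousFunction 𝔼 ℝ) (y : 𝔼) :
    slidingAverage t F y = ⨍ x in Metric.ball (0 : 𝔼) t, F (x + y) := rfl

theorem slidingAverage_apply_zero (t : ℝ) (F : BoundedContinuousFunction 𝔼 ℝ) :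
    slidingAverage t F 0 = ⨍ x in Metric.ball (0 : 𝔼) t, F x := by
  simp [slidingAverage_apply]

theorem norm_slidingAverage_le (t : ℝ) (F : BoundedContinuousFunction 𝔼 ℝ) :
    ‖slidingAverage t F‖ ≤ ‖F‖ :=
  (norm_le (norm_nonneg _)).2 fun y =>
    norm_setAverage_ball_le _ (norm_nonneg _) _ _ fun x _ => F.norm_coe_le_norm (x + y)

theorem slidingAverage_mono (t : ℝ) {F G : BoundedContinuousFunction 𝔼 ℝ} (h : F ≤ G) :
    slidingAverage t F ≤ slidingAverage t G := by
  intro y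
  change slidingAverage t F y ≤ slidingAverage t G y
  simp only [slidingAverage_apply, setAverage_eq, smul_eq_mul]
  gcongr
  · exact integrableOn_ball (translateBCF F y) 0 t
  · exact integrableOn_ball (translateBCF G y) 0 t
  · exact measurableSet_ball.nullMeasurableSet
  · exact h _

theorem slidingAverage_const {t : ℝ} (ht : 0 < t) (c : ℝ) :
    slidingAverage t (const 𝔼 c) = const 𝔼 c := by
  ext y
  simp only [slidingAverage_apply, const_apply]
  exact setAverage_const (volume_ball_ne_zero _ ht) measure_ball_lt_top.ne c

theorem abs_slidingAverage_le (t : ℝ) (F : BoundedContinuousFunction 𝔼 ℝ) :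
    |slidingAverage t F| ≤ slidingAverage t |F| := by
  refine abs_le'.2 ⟨slidingAverage_mono t (le_abs_self F), ?_⟩
  rw [← map_neg]
  exact slidingAverage_mono t (neg_le_abs F)

theorem volume_real_ball (x : 𝔼) {t : ℝ} (ht : 0 < t) :
    volume.real (Metric.ball x t) = t ^ d * volume.real (Metric.ball (0 : 𝔼) 1) := by
  rw [Measure.real, Measure.addHaar_ball_of_pos _ _ ht]
  simp [Measure.real, ENNReal.toReal_mul, ht.le]

theorem slidingAverage_translateBCF_apply (L : ℝ) (F : BoundedContinuousFunction 𝔼 ℝ) (x y : 𝔼) :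
    slidingAverage L (translateBCF F x) y =
      (volume.real (Metric.ball (0 : 𝔼) L))⁻¹ * ∫ z in Metric.ball (x + y) L, F z := by
  rw [slidingAverage_apply, setAverage_eq, smul_eq_mul]
  congr 1
  have h := (measurePreserving_add_right (volume : Measure 𝔼) (x + y)).setIntegral_preimage_emb
    (Homeomorph.addRight (x + y)).measurableEmbedding F (Metric.ball (x + y) L)
  rw [← h]
  have : (fun z : 𝔼 => z + (x + y)) ⁻¹' Metric.ball (x + y) L = Metric.ball 0 L := by
    ext z; simp
  rw [this]
  refine integral_congr_ae (Eventually.of_forall fun z => ?_)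
  simp only [translateBCF_apply]
  congr 1
  abel

theorem norm_slidingAverage_translateBCF_sub_le {t L : ℝ} (hL : 0 < L)
    (F : BoundedContinuousFunction 𝔼 ℝ) {x : 𝔼} (hx : ‖x‖ ≤ t) :
    ‖slidingAverage L (translateBCF F x) - slidingAverage L F‖ ≤
      ‖F‖ * (2 * ((1 + t / L) ^ d - 1)) := by
  have ht : 0 ≤ t := (norm_nonneg x).trans hx
  have hone : (1 : ℝ) ≤ (1 + t / L) ^ d := one_le_pow₀ (by simp; positivity)
  have hv1 : 0 < volume.real (Metric.ball (0 : 𝔼) 1) :=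
    ENNReal.toReal_pos (volume_ball_ne_zero _ one_pos) measure_ball_lt_top.ne
  have key : ∀ y z : 𝔼, ‖z‖ ≤ t →
      |(∫ w in Metric.ball y (L + t), F w) - ∫ w in Metric.ball (z + y) L, F w| ≤
        ‖F‖ * (((L + t) ^ d - L ^ d) * volume.real (Metric.ball (0 : 𝔼) 1)) := by
    intro y z hz
    have hsub : Metric.ball (z + y) L ⊆ Metric.ball y (L + t) :=
      Metric.ball_subset_ball' (by simpa using hz)
    rw [← setIntegral_sdiff measurableSet_ball (integrableOn_ball F _ _) hsub]
    refine (norm_setIntegral_le_of_norm_le_const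
      ((measure_mono Set.sdiff_subset).trans_lt measure_ball_lt_top)
      fun w _ => F.norm_coe_le_norm w).trans_eq ?_
    rw [measureReal_sdiff hsub measurableSet_ball, volume_real_ball _ hL,
      volume_real_ball _ (by positivity)]
    ring
  refine (norm_le (mul_nonneg (norm_nonneg _) (by linarith))).2 fun y => ?_
  have h0 : slidingAverage L F y = slidingAverage L (translateBCF F 0) y := by
    congr 2; ext z; simp [translateBCF_apply]
  rw [BoundedContinuousFunction.sub_apply, h0, slidingAverage_translateBCF_apply,
    slidingAverage_translateBCF_apply,
    ← mul_sub, norm_mul, norm_inv, Real.norm_of_nonneg measureReal_nonneg,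
    volume_real_ball _ hL, inv_mul_le_iff₀ (by positivity), Real.norm_eq_abs]
  have h1 := key y x hx
  have h2 := key y 0 (by simpa using ht)
  have h3 : (1 + t / L) ^ d = (L + t) ^ d / L ^ d := by rw [← div_pow]; congr 1; field_simp
  rw [h3]
  have h4 : L ^ d * volume.real (Metric.ball (0 : 𝔼) 1) *
      (‖F‖ * (2 * ((L + t) ^ d / L ^ d - 1))) =
      2 * (‖F‖ * (((L + t) ^ d - L ^ d) * volume.real (Metric.ball (0 : 𝔼) 1))) := by
    field_simp
  rw [h4]
  rw [abs_le] at *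
  constructor <;> linarith

theorem tendsto_boundary_ratio (t C : ℝ) (n : ℕ) :
    Tendsto (fun L : ℝ => C * (2 * ((1 + t / L) ^ n - 1))) atTop (𝓝 0) := by
  have h : Tendsto (fun L : ℝ => t / L) atTop (𝓝 0) := tendsto_const_nhds.div_atTop tendsto_id
  simpa using (((((tendsto_const_nhds (x := (1 : ℝ))).add h).pow n).sub_const 1).const_mul 2
    |>.const_mul C)

theorem tendsto_slidingAverage_translateBCF_sub (F : BoundedContinuousFunction 𝔼 ℝ) (x : 𝔼) :
    Tendsto (fun L : ℝ => slidingAverage L (translateBCF F x) - slidingAverage L F)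
      atTop (𝓝 0) := by
  refine squeeze_zero_norm' ?_ (tendsto_boundary_ratio ‖x‖ ‖F‖ d)
  filter_upwards [eventually_gt_atTop 0] with L hL
  exact norm_slidingAverage_translateBCF_sub_le hL F le_rfl

theorem tendsto_slidingAverage_sub_of_mem_convexHull {F P : BoundedContinuousFunction 𝔼 ℝ}
    (hP : P ∈ convexHull ℝ (Set.range (translateBCF F))) :
    Tendsto (fun L : ℝ => slidingAverage L P - slidingAverage L F) atTop (𝓝 0) := by
  refine convexHull_min (t := {P | Tendsto (fun L : ℝ => slidingAverage L P - slidingAverage L F)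
    atTop (𝓝 0)}) ?_ ?_ hP
  · rintro _ ⟨x, rfl⟩
    exact tendsto_slidingAverage_translateBCF_sub F x
  · intro G hG H hH a b _ _ hab
    have := (Tendsto.const_smul (hG : Tendsto _ _ _) a).add
      (Tendsto.const_smul (hH : Tendsto _ _ _) b)
    simp only [smul_zero, add_zero] at this
    refine this.congr fun L => ?_
    have hF : slidingAverage L F = a • slidingAverage L F + b • slidingAverage L F := by
      rw [← add_smul, hab, one_smul]
    rw [map_add, map_smul, map_smul]
    nth_rewrite 3 [hF]
    module

theorem slidingAverage_slidingAverage_apply (t L : ℝ) (F : BoundedContinuousFunction 𝔼 ℝ) (y : 𝔼) :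
    slidingAverage L (slidingAverage t F) y =
      ⨍ x in Metric.ball (0 : 𝔼) t, slidingAverage L (translateBCF F x) y := by
  have h (r : ℝ) : IsFiniteMeasure (volume.restrict (Metric.ball (0 : 𝔼) r)) :=
    isFiniteMeasure_restrict.2 measure_ball_lt_top.ne
  simp only [slidingAverage_apply, setAverage_eq, integral_smul, translateBCF_apply]
  rw [smul_comm, integral_integral_swap]
  · congr! 7
    abel
  · let G := F.compContinuous ⟨fun p : 𝔼 × 𝔼 => p.2 + (p.1 + y), by fun_prop⟩
    exact G.integrable _

theorem tendsto_slidingAverage_slidingAverage_sub {t : ℝ} (ht : 0 < t)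
    (F : BoundedContinuousFunction 𝔼 ℝ) :
    Tendsto (fun L : ℝ => slidingAverage L (slidingAverage t F) - slidingAverage L F)
      atTop (𝓝 0) := by
  refine squeeze_zero_norm' ?_ (tendsto_boundary_ratio t ‖F‖ d)
  filter_upwards [eventually_gt_atTop 0] with L hL
  have hC : 0 ≤ ‖F‖ * (2 * ((1 + t / L) ^ d - 1)) :=
    (norm_nonneg _).trans (norm_slidingAverage_translateBCF_sub_le (x := 0) hL F
      (by simpa using ht.le))
  refine (norm_le hC).2 fun y => ?_
  have hconst : slidingAverage L F y =
      ⨍ _ in Metric.ball (0 : 𝔼) t, slidingAverage L F y :=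
    (setAverage_const (volume_ball_ne_zero _ ht) measure_ball_lt_top.ne _).symm
  have hcont : Continuous fun x : 𝔼 => slidingAverage L (translateBCF F x) y := by
    have := (continuous_setAverage_ball F L).comp (continuous_const_add y)
    refine this.congr fun x => ?_
    simp only [Function.comp_apply, slidingAverage_apply, translateBCF_apply, add_assoc]
  have hintegral : IntegrableOn (fun x : 𝔼 => slidingAverage L (translateBCF F x) y)
      (Metric.ball 0 t) := by
    refine integrableOn_ball (ofNormedAddCommGroup _ hcont ‖F‖ fun x => ?_) 0 t
    exact ((slidingAverage L (translateBCF F x)).norm_coe_le_norm y).trans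
      ((norm_slidingAverage_le _ _).trans (norm_translateBCF_le F x))
  have hsub : (slidingAverage L (slidingAverage t F) - slidingAverage L F) y =
      ⨍ x in Metric.ball (0 : 𝔼) t, (slidingAverage L
        (translateBCF F x) - slidingAverage L F) y := by
    rw [BoundedContinuousFunction.sub_apply, hconst, slidingAverage_slidingAverage_apply]
    simp only [setAverage_eq, BoundedContinuousFunction.sub_apply]
    rw [integral_sub hintegral (integrableOn_const measure_ball_lt_top.ne), smul_sub]
  rw [hsub]
  refine norm_setAverage_ball_le _ hC _ _ fun x hx => ?_
  exact (norm_coe_le_norm _ y).trans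
    (norm_slidingAverage_translateBCF_sub_le hL F (by simpa using (Metric.mem_ball.1 hx).le))

/-- Functions whose sliding averages over large balls are, in the mean, close to a constant. -/
def HasErgodicAverages (F : BoundedContinuousFunction 𝔼 ℝ) : Prop :=
  ∀ ε > 0, ∃ c : ℝ, ∀ᶠ t in atTop, ∀ᶠ L in atTop,
    slidingAverage L |slidingAverage t F - const 𝔼 c| 0 ≤ ε

theorem eventually_slidingAverage_abs_sub_le {F P : BoundedContinuousFunction 𝔼 ℝ}
    (hP : P ∈ convexHull ℝ (Set.range (translateBCF F))) {c ε : ℝ} (hε : 0 < ε)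
    (h : ∀ᶠ L in atTop, slidingAverage L |P - const 𝔼 c| 0 ≤ ε) :
    ∀ᶠ t in atTop, ∀ᶠ L in atTop,
      slidingAverage L |slidingAverage t F - const 𝔼 c| 0 ≤ 3 * ε := by
  have h1 := (tendsto_slidingAverage_sub_of_mem_convexHull hP).norm
  rw [norm_zero] at h1
  filter_upwards [h1.eventually_le_const hε, eventually_gt_atTop 0] with t h1 ht
  have h2 := (tendsto_slidingAverage_slidingAverage_sub ht |P - const 𝔼 c|).norm
  rw [norm_zero] at h2
  filter_upwards [h, h2.eventually_le_const hε, eventually_gt_atTop 0] with L h h2 hL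
  have hle : |slidingAverage t F - const 𝔼 c| ≤ slidingAverage t |P - const 𝔼 c| + const 𝔼 ε := by
    intro y
    have h3 : |slidingAverage t (P - const 𝔼 c)| y ≤ slidingAverage t |P - const 𝔼 c| y :=
      abs_slidingAverage_le t _ y
    rw [map_sub, slidingAverage_const ht, BoundedContinuousFunction.abs_apply,
      BoundedContinuousFunction.sub_apply, const_apply] at h3
    have h4 := (norm_coe_le_norm _ y).trans h1
    rw [BoundedContinuousFunction.sub_apply, Real.norm_eq_abs] at h4
    change |slidingAverage t F - const 𝔼 c| y ≤ (slidingAverage t |P - const 𝔼 c| + const 𝔼 ε) y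
    rw [BoundedContinuousFunction.abs_apply, BoundedContinuousFunction.sub_apply,
      BoundedContinuousFunction.add_apply, const_apply, const_apply]
    have h5 := abs_sub_le (slidingAverage t F y) (slidingAverage t P y) c
    rw [abs_sub_comm (slidingAverage t F y) (slidingAverage t P y)] at h5
    linarith
  have h3 : slidingAverage L |slidingAverage t F - const 𝔼 c| 0 ≤
      slidingAverage L (slidingAverage t |P - const 𝔼 c| + const 𝔼 ε) 0 :=
    slidingAverage_mono L hle 0
  rw [map_add, slidingAverage_const hL, BoundedContinuousFunction.add_apply, const_apply] at h3
  have h4 := (norm_coe_le_norm _ 0).trans h2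
  rw [BoundedContinuousFunction.sub_apply, Real.norm_eq_abs, abs_le] at h4
  linarith [h4.2]

theorem hasErgodicAverages_of_convexHull {F : BoundedContinuousFunction 𝔼 ℝ}
    (h : ∀ ε > 0, ∃ c : ℝ, ∃ P ∈ convexHull ℝ (Set.range (translateBCF F)),
      ∀ᶠ L in atTop, slidingAverage L |P - const 𝔼 c| 0 ≤ ε) :
    HasErgodicAverages F := by
  intro ε hε
  obtain ⟨c, P, hP, hc⟩ := h (ε / 3) (by positivity)
  refine ⟨c, ?_⟩
  simpa [mul_div_cancel₀] using eventually_slidingAverage_abs_sub_le hP (by positivity) hc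

theorem HasErgodicAverages.of_abs_le {F G : BoundedContinuousFunction 𝔼 ℝ}
    (hF : HasErgodicAverages F) {ε : ℝ} (hε : 0 < ε) (h : ‖G - F‖ ≤ ε) :
    ∃ c : ℝ, ∀ᶠ t in atTop, ∀ᶠ L in atTop,
      slidingAverage L |slidingAverage t G - const 𝔼 c| 0 ≤ 2 * ε := by
  obtain ⟨c, hc⟩ := hF ε hε
  refine ⟨c, ?_⟩
  filter_upwards [hc] with t hc
  filter_upwards [hc, eventually_gt_atTop 0] with L hc hL
  have hle : |slidingAverage t G - const 𝔼 c| ≤ |slidingAverage t F - const 𝔼 c| + const 𝔼 ε := by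
    intro y
    have h4 := (norm_coe_le_norm _ y).trans ((norm_slidingAverage_le t (G - F)).trans h)
    rw [map_sub, BoundedContinuousFunction.sub_apply, Real.norm_eq_abs] at h4
    change |slidingAverage t G - const 𝔼 c| y ≤ (|slidingAverage t F - const 𝔼 c| + const 𝔼 ε) y
    simp only [BoundedContinuousFunction.abs_apply, BoundedContinuousFunction.sub_apply,
      BoundedContinuousFunction.add_apply, const_apply]
    linarith [abs_sub_le (slidingAverage t G y) (slidingAverage t F y) c]
  have h3 : slidingAverage L |slidingAverage t G - const 𝔼 c| 0 ≤
      slidingAverage L (|slidingAverage t F - const 𝔼 c| + const 𝔼 ε) 0 :=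
    slidingAverage_mono L hle 0
  rw [map_add, slidingAverage_const hL, BoundedContinuousFunction.add_apply, const_apply] at h3
  linarith

/-- The functions with ergodic averages form a linear subspace. -/
def ergodicAverages (d : ℕ) :
    Submodule ℝ (BoundedContinuousFunction (EuclideanSpace ℝ (Fin d)) ℝ) where
  carrier := {F | HasErgodicAverages F}
  zero_mem' := by
    intro ε hε
    refine ⟨0, Eventually.of_forall fun t => Eventually.of_forall fun L => ?_⟩
    have : const (EuclideanSpace ℝ (Fin d)) (0 : ℝ) = 0 := rfl
    simpa [this] using hε.le
  add_mem' := by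
    intro F G hF hG ε hε
    obtain ⟨a, ha⟩ := hF (ε / 2) (by positivity)
    obtain ⟨b, hb⟩ := hG (ε / 2) (by positivity)
    refine ⟨a + b, ?_⟩
    filter_upwards [ha, hb] with t ha hb
    filter_upwards [ha, hb] with L ha hb
    have hle : |slidingAverage t (F + G) - const _ (a + b)| ≤
        |slidingAverage t F - const _ a| + |slidingAverage t G - const _ b| := by
      have : slidingAverage t (F + G) - const _ (a + b) =
          (slidingAverage t F - const _ a) + (slidingAverage t G - const _ b) := by
        ext y
        simp only [map_add, BoundedContinuousFunction.sub_apply,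
          BoundedContinuousFunction.add_apply, const_apply]
        ring
      rw [this]
      exact abs_add_le _ _
    have h3 := slidingAverage_mono L hle 0
    refine h3.trans ?_
    rw [map_add]
    change slidingAverage L _ 0 + slidingAverage L _ 0 ≤ ε
    linarith
  smul_mem' := by
    intro a F hF ε hε
    obtain ⟨c, hc⟩ := hF (ε / (|a| + 1)) (by positivity)
    refine ⟨a * c, ?_⟩
    filter_upwards [hc] with t hc
    filter_upwards [hc] with L hc
    have : |slidingAverage t (a • F) - const _ (a * c)| =
        |a| • |slidingAverage t F - const _ c| := by
      ext y
      simp only [map_smul, BoundedContinuousFunction.abs_apply,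
        BoundedContinuousFunction.sub_apply, BoundedContinuousFunction.smul_apply, const_apply,
          smul_eq_mul, ← abs_mul]
      rw [mul_sub]
    rw [this, map_smul, BoundedContinuousFunction.smul_apply, smul_eq_mul]
    rw [le_div_iff₀ (by positivity)] at hc
    have h0 : 0 ≤ slidingAverage L |slidingAverage t F - const _ c| 0 := by
      have := slidingAverage_mono L (abs_nonneg (slidingAverage t F - const _ c)) 0
      simpa using this
    nlinarith

theorem isClosed_ergodicAverages :
    IsClosed (ergodicAverages d : Set (BoundedContinuousFunction 𝔼 ℝ)) := by
  refine isClosed_of_closure_subset fun F hF ε hε => ?_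
  obtain ⟨G, hG, hGF⟩ := Metric.mem_closure_iff.1 hF (ε / 2) (by positivity)
  rw [dist_eq_norm] at hGF
  simpa [mul_div_cancel₀] using HasErgodicAverages.of_abs_le hG (half_pos hε) hGF.le

theorem slidingAverage_nonneg (t : ℝ) {F : BoundedContinuousFunction 𝔼 ℝ} (hF : 0 ≤ F) (y : 𝔼) :
    0 ≤ slidingAverage t F y := by
  simpa using slidingAverage_mono t hF y

theorem eventually_abs_slidingAverage_sub_le {F : BoundedContinuousFunction 𝔼 ℝ} {c ε : ℝ}
    (hε : 0 < ε) (h : ∀ᶠ t in atTop, ∀ᶠ L in atTop,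
      slidingAverage L |slidingAverage t F - const 𝔼 c| 0 ≤ ε) :
    ∀ᶠ L in atTop, |slidingAverage L F 0 - c| ≤ 2 * ε := by
  obtain ⟨t, h, ht⟩ := (h.and (eventually_gt_atTop 0)).exists
  have h2 := (tendsto_slidingAverage_slidingAverage_sub ht F).norm
  rw [norm_zero] at h2
  filter_upwards [h, h2.eventually_le_const hε, eventually_gt_atTop 0] with L h h2 hL
  have h3 : |slidingAverage L (slidingAverage t F - const 𝔼 c)| 0 ≤ _ :=
    abs_slidingAverage_le L (slidingAverage t F - const 𝔼 c) 0
  rw [map_sub, slidingAverage_const hL, BoundedContinuousFunction.abs_apply,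
    BoundedContinuousFunction.sub_apply, const_apply] at h3
  have h4 := (norm_coe_le_norm _ 0).trans h2
  rw [BoundedContinuousFunction.sub_apply, Real.norm_eq_abs] at h4
  have h5 := abs_sub_le (slidingAverage L F 0) (slidingAverage L (slidingAverage t F) 0) c
  rw [abs_sub_comm (slidingAverage L F 0) (slidingAverage L (slidingAverage t F) 0)] at h5
  have h6 : slidingAverage L |slidingAverage t F - const 𝔼 c| 0 ≤ ε := h
  have h7 := h3.trans h6
  linarith

theorem HasErgodicAverages.exists_tendsto {F : BoundedContinuousFunction 𝔼 ℝ}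
    (hF : HasErgodicAverages F) :
    ∃ c : ℝ, Tendsto (fun L : ℝ => slidingAverage L F 0) atTop (𝓝 c) := by
  refine cauchySeq_tendsto_of_complete (Metric.cauchySeq_iff'.2 fun ε hε => ?_)
  obtain ⟨c, hc⟩ := hF (ε / 5) (by positivity)
  obtain ⟨N, hN⟩ := eventually_atTop.1 (eventually_abs_slidingAverage_sub_le (by positivity) hc)
  refine ⟨N, fun n hn => ?_⟩
  rw [Real.dist_eq]
  have h1 := hN n hn
  have h2 := hN N le_rfl
  rw [abs_le] at h1 h2
  rw [abs_lt]
  constructor <;> linarith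

theorem HasErgodicAverages.eventually_le {F : BoundedContinuousFunction 𝔼 ℝ}
    (hF : HasErgodicAverages F) {c : ℝ}
    (hc : Tendsto (fun L : ℝ => slidingAverage L F 0) atTop (𝓝 c)) {ε : ℝ} (hε : 0 < ε) :
    ∀ᶠ t in atTop, ∀ᶠ L in atTop,
      slidingAverage L |slidingAverage t F - const 𝔼 c| 0 ≤ ε := by
  obtain ⟨b, hb⟩ := hF (ε / 3) (by positivity)
  have hbc : |c - b| ≤ 2 * (ε / 3) :=
    le_of_tendsto (hc.sub_const b).abs (eventually_abs_slidingAverage_sub_le (by positivity) hb)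
  filter_upwards [hb] with t hb
  filter_upwards [hb, eventually_gt_atTop 0] with L hb hL
  have hle : |slidingAverage t F - const 𝔼 c| ≤
      |slidingAverage t F - const 𝔼 b| + const 𝔼 (2 * (ε / 3)) := by
    intro y
    change |slidingAverage t F - const 𝔼 c| y ≤
      (|slidingAverage t F - const 𝔼 b| + const 𝔼 (2 * (ε / 3))) y
    simp only [BoundedContinuousFunction.abs_apply, BoundedContinuousFunction.sub_apply,
      BoundedContinuousFunction.add_apply, const_apply]
    have := abs_sub_le (slidingAverage t F y) b c
    rw [abs_sub_comm b c] at this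
    linarith
  have h3 : slidingAverage L |slidingAverage t F - const 𝔼 c| 0 ≤
      slidingAverage L (|slidingAverage t F - const 𝔼 b| + const 𝔼 (2 * (ε / 3))) 0 :=
    slidingAverage_mono L hle 0
  rw [map_add, slidingAverage_const hL, BoundedContinuousFunction.add_apply, const_apply] at h3
  linarith

theorem HasErgodicAverages.tendsto_limsup {F : BoundedContinuousFunction 𝔼 ℝ}
    (hF : HasErgodicAverages F) {c : ℝ}
    (hc : Tendsto (fun L : ℝ => slidingAverage L F 0) atTop (𝓝 c)) :
    Tendsto (fun t : ℝ => limsup (fun L : ℝ =>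
        ⨍ y in Metric.ball (0 : 𝔼) L, |(⨍ x in Metric.ball (0 : 𝔼) t, F (x + y)) - c| ^ 2) atTop)
      atTop (𝓝 0) := by
  have hsq (t L : ℝ) :
      ⨍ y in Metric.ball (0 : 𝔼) L, |(⨍ x in Metric.ball (0 : 𝔼) t, F (x + y)) - c| ^ 2 =
        slidingAverage L (|slidingAverage t F - const 𝔼 c| ^ 2) 0 := by
    rw [slidingAverage_apply_zero]
    rfl
  have hcF : |c| ≤ ‖F‖ := le_of_tendsto hc.abs (Eventually.of_forall fun L =>
    (norm_coe_le_norm _ 0).trans (norm_slidingAverage_le L F))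
  have hle (t L : ℝ) : slidingAverage L (|slidingAverage t F - const 𝔼 c| ^ 2) 0 ≤
      2 * ‖F‖ * slidingAverage L |slidingAverage t F - const 𝔼 c| 0 := by
    have : |slidingAverage t F - const 𝔼 c| ^ 2 ≤
        (2 * ‖F‖) • |slidingAverage t F - const 𝔼 c| := by
      intro y
      change |slidingAverage t F y - c| ^ 2 ≤ 2 * ‖F‖ * |slidingAverage t F y - c|
      have h1 : |slidingAverage t F y| ≤ ‖F‖ :=
        (norm_coe_le_norm _ y).trans (norm_slidingAverage_le t F)
      have h2 : |slidingAverage t F y - c| ≤ 2 * ‖F‖ := by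
        rw [abs_le] at *
        constructor <;> linarith
      rw [sq]
      exact mul_le_mul_of_nonneg_right h2 (abs_nonneg _)
    have h3 := slidingAverage_mono L this 0
    rw [map_smul] at h3
    exact h3
  have hnonneg (t L : ℝ) : 0 ≤ slidingAverage L (|slidingAverage t F - const 𝔼 c| ^ 2) 0 :=
    slidingAverage_nonneg L (F := |slidingAverage t F - const 𝔼 c| ^ 2)
      (fun y => by
        change 0 ≤ |slidingAverage t F y - c| ^ 2
        positivity) 0
  simp only [hsq]
  refine (nhds_basis_Icc_pos (0 : ℝ)).tendsto_right_iff.2 fun ε hε => ?_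
  filter_upwards [hF.eventually_le hc (ε := ε / (2 * ‖F‖ + 1)) (by positivity)] with t ht
  have hev : ∀ᶠ L in atTop, slidingAverage L (|slidingAverage t F - const 𝔼 c| ^ 2) 0 ≤ ε := by
    filter_upwards [ht] with L hL
    refine (hle t L).trans ?_
    rw [le_div_iff₀ (by positivity)] at hL
    have := slidingAverage_nonneg L (abs_nonneg (slidingAverage t F - const 𝔼 c)) 0
    linarith
  constructor
  · have : 0 ≤ limsup (fun L : ℝ =>
        slidingAverage L (|slidingAverage t F - const 𝔼 c| ^ 2) 0) atTop :=
      le_limsup_of_frequently_le (Frequently.of_forall fun L => hnonneg t L)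
        (isBoundedUnder_of_eventually_le hev)
    linarith
  · rw [zero_add]
    exact limsup_le_of_le
      (isCoboundedUnder_le_of_eventually_le (x := 0) atTop
        (Eventually.of_forall fun L => hnonneg t L)) hev

end Sliding

section Maximal

open scoped ENNReal

variable {d : ℕ}

local notation "𝔼" => EuclideanSpace ℝ (Fin d)

theorem volume_closedBall_natCast_mul (k : ℕ) (hk : 0 < k) (x : 𝔼) (r : ℝ) :
    volume (Metric.closedBall x (k * r)) = (k : ℝ≥0∞) ^ d * volume (Metric.closedBall x r) := by
  rw [Measure.addHaar_closedBall_mul_of_pos _ _ (by exact_mod_cast hk),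
    Measure.addHaar_closedBall_center volume x]
  simp [ENNReal.ofReal_pow]

/-- Weak-type estimate: a set each of whose points is the center of a ball of bounded radius on
which `g` has mean at least `a` has measure at most `5 ^ d / a` times the integral of `g`. -/
theorem mul_volume_le_lintegral_of_closedBall {g : 𝔼 → ℝ≥0∞} {A U : Set 𝔼} {R : ℝ} {a : ℝ≥0∞}
    (h : ∀ x ∈ A, ∃ r : ℝ, 0 < r ∧ r ≤ R ∧ Metric.closedBall x r ⊆ U ∧
      a * volume (Metric.closedBall x r) ≤ ∫⁻ y in Metric.closedBall x r, g y) :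
    a * volume A ≤ 5 ^ d * ∫⁻ y in U, g y := by
  choose! r hr0 hrR hrU hr using h
  obtain ⟨u, huA, hdisj, hcov⟩ := Vitali.exists_disjoint_subfamily_covering_enlargement_closedBall
    A id r R hrR 5 (by norm_num)
  have hdisj' : u.PairwiseDisjoint fun b => Metric.closedBall b (r b) := hdisj
  have hcount : u.Countable := hdisj.countable_of_nonempty_interior fun x hx =>
    (Metric.nonempty_ball.2 (hr0 x (huA hx))).mono Metric.ball_subset_interior_closedBall
  have hsub : A ⊆ ⋃ b ∈ u, Metric.closedBall b (5 * r b) := by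
    intro x hx
    obtain ⟨b, hb, hxb⟩ := hcov x hx
    exact Set.mem_biUnion hb (hxb (Metric.mem_closedBall_self (hr0 x hx).le))
  have hcu : Countable u := hcount.to_subtype
  calc a * volume A
      ≤ a * ∑' b : u, volume (Metric.closedBall (b : 𝔼) (5 * r b)) := by
        gcongr
        exact (measure_mono hsub).trans (measure_biUnion_le _ hcount _)
    _ = 5 ^ d * ∑' b : u, a * volume (Metric.closedBall (b : 𝔼) (r b)) := by
        rw [← ENNReal.tsum_mul_left, ← ENNReal.tsum_mul_left]
        refine tsum_congr fun b => ?_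
        have := volume_closedBall_natCast_mul 5 (by norm_num) (b : 𝔼) (r b)
        push_cast at this
        rw [this]
        ring
    _ ≤ 5 ^ d * ∑' b : u, ∫⁻ y in Metric.closedBall (b : 𝔼) (r b), g y := by
        gcongr with b
        exact hr b (huA b.2)
    _ = 5 ^ d * ∫⁻ y in ⋃ b ∈ u, Metric.closedBall b (r b), g y := by
        rw [lintegral_biUnion hcount (fun b _ => Metric.isClosed_closedBall.measurableSet) hdisj']
    _ ≤ 5 ^ d * ∫⁻ y in U, g y := by
        gcongr
        exact Set.iUnion₂_subset fun b hb => hrU b (huA hb)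

theorem setLIntegral_orbit_add {Q : Type*} {T : 𝔼 → Q → Q}
    (hTadd : ∀ (x y : 𝔼) (q : Q), T (x + y) q = T x (T y q))
    (φ : Q → ℝ≥0∞) (x : 𝔼) (r : ℝ) (ω : Q) :
    ∫⁻ y in Metric.closedBall 0 r, φ (T y (T x ω)) = ∫⁻ y in Metric.closedBall x r, φ (T y ω) := by
  have h := (measurePreserving_add_right (volume : Measure 𝔼) x).setLIntegral_comp_preimage_emb
    (Homeomorph.addRight x).measurableEmbedding (fun y => φ (T y ω)) (Metric.closedBall x r)
  have : (fun z : 𝔼 => z + x) ⁻¹' Metric.closedBall x r = Metric.closedBall 0 r := by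
    ext z; simp
  simpa only [this, hTadd] using h

variable {Q : Type*} [MeasurableSpace Q] 
  {T : EuclideanSpace ℝ (Fin d) → Q → Q}

theorem measurable_lintegral_orbit (hTm : Measurable fun p : 𝔼 × Q => T p.1 p.2)
    {φ : Q → ℝ≥0∞} (hφ : Measurable φ) (s : Set 𝔼) :
    Measurable fun ω => ∫⁻ y in s, φ (T y ω) :=
  (hφ.comp hTm).lintegral_prod_left'

theorem lintegral_setLIntegral_orbit (hTm : Measurable fun p : 𝔼 × Q => T p.1 p.2)
    {μ : Measure Q} [SFinite μ] (hinv : ∀ x, Measure.map (T x) μ = μ)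
    {φ : Q → ℝ≥0∞} (hφ : Measurable φ) (s : Set 𝔼) :
    ∫⁻ ω, (∫⁻ y in s, φ (T y ω)) ∂μ = volume s * ∫⁻ ω, φ ω ∂μ := by
  rw [lintegral_lintegral_swap (f := fun ω y => φ (T y ω))
    ((hφ.comp hTm).comp measurable_swap).aemeasurable]
  have : ∀ y, ∫⁻ ω, φ (T y ω) ∂μ = ∫⁻ ω, φ ω ∂μ := fun y => by
    conv_rhs => rw [← hinv y, lintegral_map hφ (hTm.of_uncurry_left (x := y))]
  simp [this, mul_comm]

theorem maximal_inequality_of_le (hTm : Measurable fun p : 𝔼 × Q => T p.1 p.2)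
    (hTadd : ∀ (x y : 𝔼) (q : Q), T (x + y) q = T x (T y q))
    {μ : Measure Q} [SFinite μ] (hinv : ∀ x, Measure.map (T x) μ = μ)
    {φ : Q → ℝ≥0∞} (hφ : Measurable φ) (a : ℝ≥0∞) {m : ℕ} (hm : 0 < m) :
    a * μ {ω | ∃ n : ℕ, n ≤ m ∧ 0 < n ∧ a * volume (Metric.closedBall (0 : 𝔼) n) <
      ∫⁻ y in Metric.closedBall (0 : 𝔼) n, φ (T y ω)} ≤ 10 ^ d * ∫⁻ ω, φ ω ∂μ := by
  set E := {ω | ∃ n : ℕ, n ≤ m ∧ 0 < n ∧ a * volume (Metric.closedBall (0 : 𝔼) n) <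
      ∫⁻ y in Metric.closedBall (0 : 𝔼) n, φ (T y ω)} with hE
  have hEm : MeasurableSet E := by
    have : E = ⋃ n ∈ {n : ℕ | n ≤ m ∧ 0 < n}, {ω | a * volume (Metric.closedBall (0 : 𝔼) n) <
        ∫⁻ y in Metric.closedBall (0 : 𝔼) n, φ (T y ω)} := by
      ext ω; simp [hE, and_assoc]
    rw [this]
    exact MeasurableSet.biUnion (Set.to_countable _) fun n _ =>
      measurableSet_lt measurable_const (measurable_lintegral_orbit hTm hφ _)
  have hm' : (0 : ℝ) < m := by exact_mod_cast hm
  set v := volume (Metric.closedBall (0 : 𝔼) m) with hv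
  have hv0 : v ≠ 0 := (Metric.measure_closedBall_pos _ _ hm').ne'
  have hvt : v ≠ ∞ := measure_closedBall_lt_top.ne
  have hfiber : ∀ ω, a * ∫⁻ x in Metric.closedBall (0 : 𝔼) m, E.indicator 1 (T x ω) ≤
      5 ^ d * ∫⁻ y in Metric.closedBall (0 : 𝔼) (2 * m), φ (T y ω) := by
    intro ω
    have hTω : Measurable fun x => T x ω := hTm.comp measurable_prodMk_right
    have h1 : ∫⁻ x in Metric.closedBall (0 : 𝔼) m, E.indicator 1 (T x ω) =
        volume ((fun x => T x ω) ⁻¹' E ∩ Metric.closedBall (0 : 𝔼) m) := by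
      rw [← Measure.restrict_apply (hTω hEm), ← lintegral_indicator_one (hTω hEm)]
      rfl
    rw [h1]
    refine mul_volume_le_lintegral_of_closedBall (R := m) ?_
    rintro x ⟨⟨n, hnm, hn0, hn⟩, hx⟩
    refine ⟨n, by exact_mod_cast hn0, by exact_mod_cast hnm, ?_, ?_⟩
    · refine Metric.closedBall_subset_closedBall' ?_
      have : (n : ℝ) ≤ m := by exact_mod_cast hnm
      have := Metric.mem_closedBall.1 hx
      linarith
    · rw [setLIntegral_orbit_add hTadd] at hn
      rw [Measure.addHaar_closedBall_center]
      exact hn.le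
  have hone : Measurable (E.indicator (1 : Q → ℝ≥0∞)) := measurable_one.indicator hEm
  have hmain : v * (a * μ E) ≤ v * (10 ^ d * ∫⁻ ω, φ ω ∂μ) := by
    calc v * (a * μ E) = a * (v * ∫⁻ ω, E.indicator 1 ω ∂μ) := by
          rw [lintegral_indicator_one hEm]; ring
      _ = ∫⁻ ω, (a * ∫⁻ x in Metric.closedBall (0 : 𝔼) m, E.indicator 1 (T x ω)) ∂μ := by
          rw [lintegral_const_mul _ (measurable_lintegral_orbit hTm hone _),
            lintegral_setLIntegral_orbit hTm hinv hone]
      _ ≤ ∫⁻ ω, (5 ^ d * ∫⁻ y in Metric.closedBall (0 : 𝔼) (2 * m), φ (T y ω)) ∂μ :=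
          lintegral_mono hfiber
      _ = 5 ^ d * (2 ^ d * v * ∫⁻ ω, φ ω ∂μ) := by
          rw [lintegral_const_mul _ (measurable_lintegral_orbit hTm hφ _),
            lintegral_setLIntegral_orbit hTm hinv hφ]
          have := volume_closedBall_natCast_mul 2 (by norm_num) (0 : 𝔼) m
          push_cast at this
          rw [this]
      _ = v * (10 ^ d * ∫⁻ ω, φ ω ∂μ) := by
          rw [show (10 : ℝ≥0∞) = 5 * 2 by norm_num, mul_pow]; ring
  exact (ENNReal.mul_le_mul_iff_right hv0 hvt).1 hmain

/-- The maximal inequality for averages over balls of integer radii along the orbits of a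
measure-preserving action of `ℝ^d`. -/
theorem maximal_inequality (hTm : Measurable fun p : 𝔼 × Q => T p.1 p.2)
    (hTadd : ∀ (x y : 𝔼) (q : Q), T (x + y) q = T x (T y q))
    {μ : Measure Q} [SFinite μ] (hinv : ∀ x, Measure.map (T x) μ = μ)
    {φ : Q → ℝ≥0∞} (hφ : Measurable φ) (a : ℝ≥0∞) :
    a * μ {ω | ∃ n : ℕ, 0 < n ∧ a * volume (Metric.closedBall (0 : 𝔼) n) <
      ∫⁻ y in Metric.closedBall (0 : 𝔼) n, φ (T y ω)} ≤ 10 ^ d * ∫⁻ ω, φ ω ∂μ := by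
  have hunion : {ω | ∃ n : ℕ, 0 < n ∧ a * volume (Metric.closedBall (0 : 𝔼) n) <
      ∫⁻ y in Metric.closedBall (0 : 𝔼) n, φ (T y ω)} =
      ⋃ m : ℕ, {ω | ∃ n : ℕ, n ≤ m + 1 ∧ 0 < n ∧ a * volume (Metric.closedBall (0 : 𝔼) n) <
        ∫⁻ y in Metric.closedBall (0 : 𝔼) n, φ (T y ω)} := by
    ext ω
    simp only [Set.mem_ofPred_eq, Set.mem_iUnion]
    exact ⟨fun ⟨n, hn⟩ => ⟨n, n, by omega, hn⟩, fun ⟨_, n, _, hn⟩ => ⟨n, hn⟩⟩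
  rw [hunion, Monotone.measure_iUnion, ENNReal.mul_iSup]
  · exact iSup_le fun m => maximal_inequality_of_le hTm hTadd hinv hφ a m.succ_pos
  · rintro i j hij ω ⟨n, hn, h⟩
    exact ⟨n, by omega, h⟩

end Maximal

section Dynamics

open scoped ENNReal NNReal

variable {d : ℕ} {Q : Type*} [TopologicalSpace Q]
  {Φ : C(EuclideanSpace ℝ (Fin d) × Q, Q)}

local notation "𝔼" => EuclideanSpace ℝ (Fin d)

theorem comp_curry_comp_curry (hadd : ∀ (x y : 𝔼) (q : Q), Φ (x + y, q) = Φ (x, Φ (y, q)))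
    (f : C(Q, ℝ)) (x y : 𝔼) :
    (f.comp (Φ.curry x)).comp (Φ.curry y) = f.comp (Φ.curry (x + y)) := by
  ext q
  simp [hadd]

variable [CompactSpace Q]

/-- Von Neumann's mean ergodic theorem: convex combinations of the translates of `f` along the
flow approximate a function that is almost everywhere invariant. -/
theorem exists_invariant_limit [MeasurableSpace Q] [BorelSpace Q]
    (hadd : ∀ (x y : 𝔼) (q : Q), Φ (x + y, q) = Φ (x, Φ (y, q)))
    (μ : Measure Q) [IsProbabilityMeasure μ] (hinv : ∀ x, Measure.map (Φ.curry x) μ = μ)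
    (f : C(Q, ℝ)) :
    ∃ g : Q → ℝ, Measurable g ∧ (∀ x, ∀ᵐ ω ∂μ, g (Φ (x, ω)) = g ω) ∧
      ∀ δ : ℝ≥0∞, δ ≠ 0 → ∃ p ∈ convexHull ℝ (Set.range fun x => f.comp (Φ.curry x)),
        ∫⁻ ω, ‖p ω - g ω‖ₑ ∂μ ≤ δ := by
  set H := convexHull ℝ (Set.range fun x => f.comp (Φ.curry x)) with hH
  let ι : C(Q, ℝ) →L[ℝ] Lp ℝ 2 μ := ContinuousMap.toLp 2 μ ℝ
  have hmp (x : 𝔼) : MeasurePreserving (Φ.curry x) μ μ := ⟨(Φ.curry x).measurable, hinv x⟩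
  let U (x : 𝔼) : Lp ℝ 2 μ →ₗᵢ[ℝ] Lp ℝ 2 μ := Lp.compMeasurePreservingₗᵢ ℝ (Φ.curry x) (hmp x)
  have hUcoe (x : 𝔼) (v : Lp ℝ 2 μ) : U x v =ᵐ[μ] v ∘ Φ.curry x :=
    Lp.coeFn_compMeasurePreserving v (hmp x)
  have hUι (x : 𝔼) (p : C(Q, ℝ)) : U x (ι p) = ι (p.comp (Φ.curry x)) := by
    refine Lp.ext ?_
    filter_upwards [hUcoe x (ι p), ContinuousMap.coeFn_toLp (p := 2) (𝕜 := ℝ) μ (p.comp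
      (Φ.curry x)),
      (hmp x).quasiMeasurePreserving.ae (ContinuousMap.coeFn_toLp (p := 2) (𝕜 := ℝ) μ p)]
      with ω h1 h2 h3
    rw [h1, h2]
    exact h3
  have hHinv (x : 𝔼) {p : C(Q, ℝ)} (hp : p ∈ H) : p.comp (Φ.curry x) ∈ H := by
    let A := (ContinuousMap.compRightAlgHom ℝ ℝ (Φ.curry x)).toLinearMap
    have h1 : A p ∈ A '' H := Set.mem_image_of_mem _ hp
    rw [hH, LinearMap.image_convexHull] at h1
    refine convexHull_mono ?_ h1
    rintro _ ⟨_, ⟨y, rfl⟩, rfl⟩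
    exact ⟨y + x, (comp_curry_comp_curry hadd f y x).symm⟩
  set K := closure (ι '' H) with hK
  have hKconv : Convex ℝ K := ((convex_convexHull ℝ _).linear_image ι.toLinearMap).closure
  have hKne : K.Nonempty :=
    ((Set.range_nonempty _).convexHull.image ι).closure
  have hUK (x : 𝔼) : ∀ v ∈ K, U x v ∈ K := by
    intro v hv
    refine map_mem_closure (U x).continuous hv ?_
    rintro _ ⟨p, hp, rfl⟩
    exact ⟨_, hHinv x hp, (hUι x p).symm⟩
  obtain ⟨v, hvK, hv⟩ := exists_norm_eq_iInf_of_complete_convex hKne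
    isClosed_closure.isComplete hKconv 0
  rw [norm_eq_iInf_iff_real_inner_le_zero hKconv hvK] at hv
  have hfix (x : 𝔼) : U x v = v := by
    have h1 := hv _ (hUK x v hvK)
    rw [zero_sub, inner_neg_left, inner_sub_right, real_inner_self_eq_norm_sq] at h1
    have h2 := norm_sub_sq_real v (U x v)
    rw [(U x).norm_map] at h2
    have h3 : ‖v - U x v‖ = 0 := by nlinarith [norm_nonneg (v - U x v)]
    exact (sub_eq_zero.1 (norm_eq_zero.1 h3)).symm
  refine ⟨v, (Lp.stronglyMeasurable v).measurable, fun x => ?_, fun δ hδ => ?_⟩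
  · have h := hUcoe x v
    rw [hfix x] at h
    filter_upwards [h] with ω hω
    exact hω.symm
  · obtain ⟨_, ⟨p, hp, rfl⟩, hpv⟩ := EMetric.mem_closure_iff.1 hvK δ (pos_iff_ne_zero.2 hδ)
    refine ⟨p, hp, ?_⟩
    have hae : (fun ω => p ω - v ω) =ᵐ[μ] (ι p - v : Lp ℝ 2 μ) := by
      filter_upwards [Lp.coeFn_sub (ι p) v, ContinuousMap.coeFn_toLp (p := 2) (𝕜 := ℝ) μ p]
        with ω h1 h2
      rw [h1, Pi.sub_apply, h2]
    calc ∫⁻ ω, ‖p ω - v ω‖ₑ ∂μ = eLpNorm (fun ω => p ω - v ω) 1 μ :=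
          eLpNorm_one_eq_lintegral_enorm.symm
      _ = eLpNorm (ι p - v : Lp ℝ 2 μ) 1 μ := eLpNorm_congr_ae hae
      _ ≤ eLpNorm (ι p - v : Lp ℝ 2 μ) 2 μ :=
          eLpNorm_le_eLpNorm_of_exponent_le (by norm_num) (Lp.aestronglyMeasurable _)
      _ = edist v (ι p) := by rw [← Lp.enorm_def, ← edist_eq_enorm_sub, edist_comm]
      _ ≤ δ := hpv.le

/-- The realization `y ↦ f (Φ (y, ω))` of `f` at the point `ω`. -/
noncomputable def realization (Φ : C(EuclideanSpace ℝ (Fin d) × Q, Q)) (ω : Q) :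
    C(Q, ℝ) →ₐ[ℝ] BoundedContinuousFunction (EuclideanSpace ℝ (Fin d)) ℝ where
  toFun f := (BoundedContinuousFunction.mkOfCompact f).compContinuous
    ⟨fun y => Φ (y, ω), by fun_prop⟩
  map_one' := rfl
  map_mul' _ _ := rfl
  map_zero' := rfl
  map_add' _ _ := rfl
  commutes' _ := rfl

theorem realization_apply (ω : Q) (f : C(Q, ℝ)) (y : 𝔼) : realization Φ ω f y = f (Φ (y, ω)) := rfl

theorem norm_realization_le (ω : Q) (f : C(Q, ℝ)) : ‖realization Φ ω f‖ ≤ ‖f‖ :=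
  (BoundedContinuousFunction.norm_le (norm_nonneg _)).2 fun y => f.norm_coe_le_norm (Φ (y, ω))

theorem continuous_realization (ω : Q) : Continuous (realization Φ ω) :=
  AddMonoidHomClass.continuous_of_bound (realization Φ ω) 1
    fun f => by simpa using norm_realization_le ω f

theorem realization_comp_curry (hadd : ∀ (x y : 𝔼) (q : Q), Φ (x + y, q) = Φ (x, Φ (y, q)))
    (ω : Q) (f : C(Q, ℝ)) (x : 𝔼) :
    realization Φ ω (f.comp (Φ.curry x)) = translateBCF (realization Φ ω f) x := by
  ext y
  simp [realization_apply, translateBCF_apply, add_comm y x, hadd]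

theorem continuous_comp_curry : Continuous fun p : C(Q, ℝ) × 𝔼 => p.1.comp (Φ.curry p.2) :=
  ContinuousMap.continuous_comp'.comp
    ((Φ.curry.continuous.comp continuous_snd).prodMk continuous_fst)

theorem uniformContinuous_realization
    (hadd : ∀ (x y : 𝔼) (q : Q), Φ (x + y, q) = Φ (x, Φ (y, q)))
    (ω : Q) (f : C(Q, ℝ)) : UniformContinuous (realization Φ ω f) := by
  rw [Metric.uniformContinuous_iff]
  intro ε hε
  have hcont : Continuous fun x => f.comp (Φ.curry x) :=
    continuous_comp_curry.comp (continuous_const.prodMk continuous_id)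
  obtain ⟨δ, hδ, h⟩ := Metric.continuous_iff.1 hcont 0 ε hε
  refine ⟨δ, hδ, fun {a b} hab => ?_⟩
  have h1 := h (a - b) (by simpa [dist_eq_norm] using hab)
  have h2 := (ContinuousMap.dist_apply_le_dist (Φ (b, ω))).trans_lt h1
  simpa [realization_apply, ← hadd] using h2

theorem slidingAverage_abs_sub_const_le {P : BoundedContinuousFunction 𝔼 ℝ} {c ε L : ℝ}
    (hε : 0 ≤ ε) (hL : 1 ≤ L)
    (h : ∀ n : ℕ, 0 < n → ∫⁻ y in Metric.closedBall (0 : 𝔼) n, ‖P y - c‖ₑ ≤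
      ENNReal.ofReal ε * volume (Metric.closedBall (0 : 𝔼) n)) :
    slidingAverage L |P - BoundedContinuousFunction.const 𝔼 c| 0 ≤ 2 ^ d * ε := by
  have hL0 : 0 < L := by linarith
  have hv : 0 < volume.real (Metric.ball (0 : 𝔼) L) :=
    ENNReal.toReal_pos (volume_ball_ne_zero _ hL0) measure_ball_lt_top.ne
  have hceil : (⌈L⌉₊ : ℝ) ≤ 2 * L := by linarith [Nat.ceil_lt_add_one hL0.le]
  have hvol : volume (Metric.closedBall (0 : 𝔼) ⌈L⌉₊) ≤ 2 ^ d * volume (Metric.ball (0 : 𝔼) L) := by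
    rw [Measure.addHaar_ball_of_pos _ _ hL0, ← Measure.addHaar_closedBall _ (0 : 𝔼) hL0.le]
    have := volume_closedBall_natCast_mul 2 (by norm_num) (0 : 𝔼) L
    push_cast at this
    rw [← this]
    exact measure_mono (Metric.closedBall_subset_closedBall hceil)
  have hlin : ∫⁻ y in Metric.ball (0 : 𝔼) L, ‖P y - c‖ₑ ≤
      ENNReal.ofReal ε * (2 ^ d * volume (Metric.ball (0 : 𝔼) L)) :=
    (lintegral_mono_set (Metric.ball_subset_closedBall.trans
      (Metric.closedBall_subset_closedBall (Nat.le_ceil L)))).trans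
      ((h ⌈L⌉₊ (Nat.ceil_pos.2 hL0)).trans (by gcongr))
  have hintegral : ∫ y in Metric.ball (0 : 𝔼) L, ‖P y - c‖ ≤
      ε * (2 ^ d * volume.real (Metric.ball (0 : 𝔼) L)) := by
    rw [integral_norm_eq_lintegral_enorm (f := fun y => P y - c)
      (P.continuous.sub continuous_const).aestronglyMeasurable]
    refine (ENNReal.toReal_mono ?_ hlin).trans_eq ?_
    · exact ENNReal.mul_ne_top ENNReal.ofReal_ne_top
        (ENNReal.mul_ne_top (by simp) measure_ball_lt_top.ne)
    · simp [ENNReal.toReal_mul, ENNReal.toReal_ofReal hε, Measure.real]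
  rw [slidingAverage_apply_zero, setAverage_eq, smul_eq_mul, inv_mul_le_iff₀ hv]
  refine hintegral.trans_eq ?_
  ring

theorem ae_exists_mem_convexHull [MeasurableSpace Q] [BorelSpace Q]
    (hadd : ∀ (x y : 𝔼) (q : Q), Φ (x + y, q) = Φ (x, Φ (y, q)))
    {μ : Measure Q} [IsProbabilityMeasure μ] (hinv : ∀ x, Measure.map (Φ.curry x) μ = μ)
    {g : Q → ℝ} (hg : Measurable g) {H : Set C(Q, ℝ)}
    (hH : ∀ δ : ℝ≥0∞, δ ≠ 0 → ∃ p ∈ H, ∫⁻ ω, ‖p ω - g ω‖ₑ ∂μ ≤ δ)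
    {ε : ℝ≥0∞} (hε : ε ≠ 0) :
    ∀ᵐ ω ∂μ, ∃ p ∈ H, ∀ n : ℕ, 0 < n →
      ∫⁻ y in Metric.closedBall (0 : 𝔼) n, ‖p (Φ (y, ω)) - g (Φ (y, ω))‖ₑ ≤
        ε * volume (Metric.closedBall (0 : 𝔼) n) := by
  rw [ae_iff]
  set B := {ω | ¬ ∃ p ∈ H, ∀ n : ℕ, 0 < n →
      ∫⁻ y in Metric.closedBall (0 : 𝔼) n, ‖p (Φ (y, ω)) - g (Φ (y, ω))‖ₑ ≤
        ε * volume (Metric.closedBall (0 : 𝔼) n)} with hB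
  have hle : ε * μ B ≤ 0 := by
    refine ENNReal.le_of_forall_pos_le_add fun η hη _ => ?_
    have hη' : (η : ℝ≥0∞) ≠ 0 := by exact_mod_cast hη.ne'
    obtain ⟨p, hp, hpδ⟩ := hH (η / 10 ^ d) (ENNReal.div_ne_zero.2 ⟨hη', by simp⟩)
    have hmax := maximal_inequality (T := fun x q => Φ (x, q)) Φ.continuous.measurable hadd hinv
      (φ := fun ω => ‖p ω - g ω‖ₑ) (p.continuous.measurable.sub hg).enorm ε
    have hsub : B ⊆ {ω | ∃ n : ℕ, 0 < n ∧ ε * volume (Metric.closedBall (0 : 𝔼) n) <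
        ∫⁻ y in Metric.closedBall (0 : 𝔼) n, ‖p (Φ (y, ω)) - g (Φ (y, ω))‖ₑ} := by
      intro ω hω
      by_contra hcon
      refine hω ⟨p, hp, fun n hn => ?_⟩
      by_contra hlt
      exact hcon ⟨n, hn, not_le.1 hlt⟩
    calc ε * μ B ≤ _ := by gcongr
      _ ≤ 10 ^ d * ∫⁻ ω, ‖p ω - g ω‖ₑ ∂μ := hmax
      _ ≤ 10 ^ d * (η / 10 ^ d) := by gcongr
      _ ≤ 0 + η := by rw [zero_add]; exact ENNReal.mul_div_le
  exact (mul_eq_zero.1 (nonpos_iff_eq_zero.1 hle)).resolve_left hε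

/-- Almost every realization of a continuous function has ergodic averages. -/
theorem ae_hasErgodicAverages_realization [MeasurableSpace Q] [BorelSpace Q]
    (hadd : ∀ (x y : 𝔼) (q : Q), Φ (x + y, q) = Φ (x, Φ (y, q)))
    (μ : Measure Q) [IsProbabilityMeasure μ] (hinv : ∀ x, Measure.map (Φ.curry x) μ = μ)
    (f : C(Q, ℝ)) : ∀ᵐ ω ∂μ, HasErgodicAverages (realization Φ ω f) := by
  obtain ⟨g, hg, hginv, hH⟩ := exists_invariant_limit hadd μ hinv f
  have hΦ : Measurable Φ := Φ.continuous.measurable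
  have horbit : ∀ᵐ ω ∂μ, ∀ᵐ y : 𝔼, g (Φ (y, ω)) = g ω := by
    refine (Measure.ae_ae_comm (p := fun (y : 𝔼) ω => g (Φ (y, ω)) = g ω) ?_).1
      (Eventually.of_forall hginv)
    exact measurableSet_eq_fun (hg.comp hΦ) (hg.comp measurable_snd)
  have hhull : ∀ᵐ ω ∂μ, ∀ k : ℕ, ∃ p ∈ convexHull ℝ (Set.range fun x => f.comp (Φ.curry x)),
      ∀ n : ℕ, 0 < n → ∫⁻ y in Metric.closedBall (0 : 𝔼) n, ‖p (Φ (y, ω)) - g (Φ (y, ω))‖ₑ ≤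
        ENNReal.ofReal (1 / (k + 1)) * volume (Metric.closedBall (0 : 𝔼) n) :=
    ae_all_iff.2 fun k => ae_exists_mem_convexHull hadd hinv hg hH
      (by simpa using Nat.cast_add_one_pos k)
  filter_upwards [horbit, hhull] with ω horbit hhull
  refine hasErgodicAverages_of_convexHull fun ε hε => ?_
  obtain ⟨k, hk⟩ := exists_nat_one_div_lt (show 0 < ε / 2 ^ d by positivity)
  obtain ⟨p, hp, hpn⟩ := hhull k
  refine ⟨g ω, realization Φ ω p, ?_, ?_⟩
  · have h1 := Set.mem_image_of_mem (realization Φ ω).toLinearMap hp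
    rw [LinearMap.image_convexHull] at h1
    refine convexHull_mono ?_ h1
    rintro _ ⟨_, ⟨x, rfl⟩, rfl⟩
    exact ⟨x, (realization_comp_curry hadd ω f x).symm⟩
  · filter_upwards [eventually_ge_atTop 1] with L hL
    refine (slidingAverage_abs_sub_const_le (ε := 1 / (k + 1)) (by positivity) hL
      fun n hn => ?_).trans ?_
    · refine (lintegral_congr_ae ?_).trans_le (hpn n hn)
      filter_upwards [ae_restrict_of_ae horbit] with y hy
      rw [realization_apply, hy]
    · rw [lt_div_iff₀' (by positivity)] at hk
      exact hk.le

theorem Submonoid.countable_closure {M : Type*} [Monoid M] {s : Set M} (hs : s.Countable) :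
    (Submonoid.closure s : Set M).Countable := by
  have : Countable s := hs.to_subtype
  have : Countable (FreeMonoid s) := inferInstanceAs (Countable (List s))
  rw [Submonoid.closure_eq_mrange, MonoidHom.coe_mrange]
  exact Set.countable_range _

theorem ae_hasErgodicAverages_realization_adjoin [MeasurableSpace Q] [BorelSpace Q]
    (hadd : ∀ (x y : 𝔼) (q : Q), Φ (x + y, q) = Φ (x, Φ (y, q)))
    (μ : Measure Q) [IsProbabilityMeasure μ] (hinv : ∀ x, Measure.map (Φ.curry x) μ = μ)
    {D : Set C(Q, ℝ)} (hD : TopologicalSpace.IsSeparable D) :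
    ∀ᵐ ω ∂μ, ∀ f ∈ Algebra.adjoin ℝ D, HasErgodicAverages (realization Φ ω f) := by
  obtain ⟨C, hC, hDC⟩ := hD
  have hae : ∀ᵐ ω ∂μ, ∀ f ∈ Submonoid.closure C, HasErgodicAverages (realization Φ ω f) :=
    (ae_ball_iff (Submonoid.countable_closure hC)).2 fun f _ =>
      ae_hasErgodicAverages_realization hadd μ hinv f
  filter_upwards [hae] with ω hω f hf
  let W := (ergodicAverages d).comap (realization Φ ω).toLinearMap
  have hWC : (Algebra.adjoin ℝ C : Set C(Q, ℝ)) ⊆ W := by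
    have : Subalgebra.toSubmodule (Algebra.adjoin ℝ C) ≤ W := by
      rw [Algebra.adjoin_eq_span]
      exact Submodule.span_le.2 hω
    exact this
  have hW : IsClosed (W : Set C(Q, ℝ)) :=
    isClosed_ergodicAverages.preimage (continuous_realization ω)
  have hD' : Algebra.adjoin ℝ D ≤ (Algebra.adjoin ℝ C).topologicalClosure :=
    Algebra.adjoin_le (hDC.trans (closure_mono Algebra.subset_adjoin))
  exact closure_minimal hWC hW (hD' hf)

theorem lipschitzWith_translateBCF (y : 𝔼) :
    LipschitzWith 1 fun F : BoundedContinuousFunction 𝔼 ℝ => translateBCF F y :=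
  BoundedContinuousFunction.lipschitz_compContinuous _

/-- The closure of the image of an invariant subalgebra under a realization map is an ergodic
algebra with mean value, provided all realizations have ergodic averages. -/
theorem isAlgebraWithMeanValue_closure_realization
    (hadd : ∀ (x y : 𝔼) (q : Q), Φ (x + y, q) = Φ (x, Φ (y, q)))
    {W : Subalgebra ℝ C(Q, ℝ)} (hW : ∀ f ∈ W, ∀ x : 𝔼, f.comp (Φ.curry x) ∈ W) {ω : Q}
    (hω : ∀ f ∈ W, HasErgodicAverages (realization Φ ω f)) :
    IsAlgebraWithMeanValue ((W.map (realization Φ ω)).topologicalClosure :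
      Set (BoundedContinuousFunction 𝔼 ℝ)) ∧
    SatisfiesErgodicityCriterion ((W.map (realization Φ ω)).topologicalClosure :
      Set (BoundedContinuousFunction 𝔼 ℝ)) := by
  set A := (W.map (realization Φ ω)).topologicalClosure
  have hclosed : IsClosed (A : Set (BoundedContinuousFunction 𝔼 ℝ)) :=
    Subalgebra.isClosed_topologicalClosure _
  have herg : ∀ F ∈ A, HasErgodicAverages F := by
    intro F hF
    refine closure_minimal ?_ isClosed_ergodicAverages hF
    rintro _ ⟨f, hf, rfl⟩
    exact hω f hf
  refine ⟨⟨?_, fun _ hf _ hg => A.add_mem hf hg, fun c _ hf => A.smul_mem hf c,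
    fun _ hf _ hg => A.mul_mem hf hg, hclosed, A.one_mem, ?_, ?_⟩, ?_⟩
  · intro F hF
    refine uniformContinuous_of_uniform_approx_of_uniformContinuous fun u hu => ?_
    obtain ⟨ε, hε, hεu⟩ := Metric.mem_uniformity_dist.1 hu
    obtain ⟨_, ⟨f, -, rfl⟩, hf⟩ := Metric.mem_closure_iff.1 hF ε hε
    exact ⟨_, uniformContinuous_realization hadd ω f, fun y =>
      hεu ((BoundedContinuousFunction.dist_coe_le_dist y).trans_lt hf)⟩
  · intro F hF y
    refine map_mem_closure (f := fun F => translateBCF F y)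
      (lipschitzWith_translateBCF y).continuous hF ?_
    rintro _ ⟨f, hf, rfl⟩
    exact ⟨_, hW f hf y, realization_comp_curry hadd ω f y⟩
  · intro F hF
    simpa only [slidingAverage_apply_zero] using (herg F hF).exists_tendsto
  · intro F hF
    obtain ⟨c, hc⟩ := (herg F hF).exists_tendsto
    refine ⟨c, ?_, (herg F hF).tendsto_limsup hc⟩
    simpa only [slidingAverage_apply_zero] using hc

end Dynamics

/-- Realizations of a continuous dynamical system lie in an ergodic algebra: given a compact
Hausdorff space `Q`, a continuous `ℝ^d`-dynamical system `T` on `Q`, an invariant regular Borel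
probability measure `μ`, and a separable subspace `V ⊆ C(Q, ℝ)`, for `μ`-almost every `ω` there
is an algebra with mean value satisfying the ergodicity criterion that contains all the
realizations `y ↦ f (T y ω)`, `f ∈ V`. -/
theorem realizations_in_ergodic_algebra {d : ℕ}
    (Q : Type) [TopologicalSpace Q] [CompactSpace Q] [T2Space Q]
    [MeasurableSpace Q] [BorelSpace Q]
    (T : EuclideanSpace ℝ (Fin d) → Q → Q)
    (hTcont : Continuous fun p : EuclideanSpace ℝ (Fin d) × Q => T p.1 p.2)
    (hT0 : ∀ q : Q, T 0 q = q)
    (hTadd : ∀ (x y : EuclideanSpace ℝ (Fin d)) (q : Q), T (x + y) q = T x (T y q))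
    (μ : Measure Q) [IsProbabilityMeasure μ] (hreg : μ.Regular)
    (hinv : ∀ x : EuclideanSpace ℝ (Fin d), Measure.map (T x) μ = μ)
    (V : Submodule ℝ C(Q, ℝ)) (hV : TopologicalSpace.IsSeparable (V : Set C(Q, ℝ))) :
    ∀ᵐ ω ∂μ, ∃ 𝒜 : Set (BoundedContinuousFunction (EuclideanSpace ℝ (Fin d)) ℝ),
      IsAlgebraWithMeanValue 𝒜 ∧ SatisfiesErgodicityCriterion 𝒜 ∧
      ∀ f ∈ V, ∃ F ∈ 𝒜, ∀ y : EuclideanSpace ℝ (Fin d), F y = f (T y ω) := by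
  let Φ : C(EuclideanSpace ℝ (Fin d) × Q, Q) := ⟨fun p => T p.1 p.2, hTcont⟩
  let τ : C(Q, ℝ) × EuclideanSpace ℝ (Fin d) → C(Q, ℝ) := fun p => p.1.comp (Φ.curry p.2)
  have hadd : ∀ x y q, Φ (x + y, q) = Φ (x, Φ (y, q)) := hTadd
  set D : Set C(Q, ℝ) := τ '' ((V : Set C(Q, ℝ)) ×ˢ Set.univ)
  have hD : TopologicalSpace.IsSeparable D :=
    (hV.prod (TopologicalSpace.isSeparable_univ_iff.2 inferInstance)).image continuous_comp_curry
  have hinvariant : ∀ f ∈ Algebra.adjoin ℝ D, ∀ x, f.comp (Φ.curry x) ∈ Algebra.adjoin ℝ D := by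
    intro f hf x
    have hle : Algebra.adjoin ℝ D ≤
        (Algebra.adjoin ℝ D).comap (ContinuousMap.compRightAlgHom ℝ ℝ (Φ.curry x)) := by
      refine Algebra.adjoin_le ?_
      rintro _ ⟨⟨f, y⟩, hf, rfl⟩
      refine Algebra.subset_adjoin ⟨(f, y + x), ⟨hf.1, trivial⟩, ?_⟩
      exact (comp_curry_comp_curry hadd f y x).symm
    exact hle hf
  filter_upwards [ae_hasErgodicAverages_realization_adjoin hadd μ hinv hD] with ω hω
  obtain ⟨h1, h2⟩ := isAlgebraWithMeanValue_closure_realization hadd hinvariant hω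
  refine ⟨_, h1, h2, fun f hf => ⟨realization Φ ω f, ?_, fun y => rfl⟩⟩
  refine Subalgebra.le_topologicalClosure _
    ⟨f, Algebra.subset_adjoin ⟨(f, 0), ⟨hf, trivial⟩, ?_⟩, rfl⟩
  ext q
  exact congrArg f (hT0 q)
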